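/- For every integer n ≥ 1 there exists a bijection φ from the set of Catalan tableaux of index n to the set of binary trees with n vertices such that for every Catalan tableau T of index n: (1) the profile of T equals the canopy of φ(T); (2) the length of the left branch of φ(T) equals the number of 1's in the first row of T, augmented by 1; (3) the length of the right branch of φ(T) equals the number of unrestricted rows of T (equivalently, the number of unrestricted rows other than the first row, augmented by 1, since the first row is always unrestricted). -/

import Mathlib

/-- A binary tree: empty, or a root with a left and a right subtree. -/
inductive BinTree : Type
  | nil : BinTree
  | node : BinTree → BinTree → BinTree
  deriving DecidableEq

/-- Number of vertices of a binary tree. -/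
def BinTree.size : BinTree → ℕ
  | .nil => 0
  | .node l r => l.size + r.size + 1

/-- Length (number of vertices) of the left branch. -/
def BinTree.leftBranchLen : BinTree → ℕ
  | .nil => 0
  | .node l _ => l.leftBranchLen + 1

/-- Length (number of vertices) of the right branch. -/
def BinTree.rightBranchLen : BinTree → ℕ
  | .nil => 0
  | .node _ r => r.rightBranchLen + 1

/-- Word over {a,b} (a = `true`, b = `false`) reading the vertices in symmetric
(in-)order; a vertex contributes `true` iff it has a right child. -/
def BinTree.canopyFull : BinTree → List Bool
  | .nil => []
  | .node l r => l.canopyFull ++ (decide (r ≠ BinTree.nil)) :: r.canopyFull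

/-- The canopy of a binary tree with `n` vertices: the word `u₁ … u_{n-1}` over
{a = `true`, b = `false`} with `uᵢ = a` iff the `i`-th vertex in symmetric order
has a right child.  (The last vertex in symmetric order never has a right child,
so it is dropped.) -/
def BinTree.canopy (B : BinTree) : List Bool := B.canopyFull.dropLast

/-- A Catalan tableau of index `n`: a partition `λ₁ ≥ … ≥ λ_k` with `λ₁ = n - k`,
drawn right-justified inside the `k × (n-k)` rectangle (rows bottom to top, row `i`
having `lam i` cells, occupying columns `j` with `m - lam i ≤ j < m` where
`m = n - k`), filled with 0's (`false`) and 1's (`true`) such that every column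
contains exactly one 1 and no 0 has both a 1 below it in its column and a 1 to
its right in its row.  Entries outside the diagram are forced to `false`. -/
structure CatalanTableau (n : ℕ) where
  k : ℕ
  m : ℕ
  hk : 0 < k
  hkm : k + m = n
  lam : Fin k → ℕ
  lam_le : ∀ i, lam i ≤ m
  lam_first : lam ⟨0, hk⟩ = m
  lam_anti : ∀ i j : Fin k, i ≤ j → lam j ≤ lam i
  f : Fin k → Fin m → Bool
  f_outside : ∀ (i : Fin k) (j : Fin m), (j : ℕ) < m - lam i → f i j = false
  col_one : ∀ j : Fin m, ∃! i : Fin k, f i j = true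
  no_bad : ∀ (i : Fin k) (j : Fin m), m - lam i ≤ (j : ℕ) → f i j = false →
    ¬ ((∃ i' : Fin k, i' < i ∧ f i' j = true) ∧
       (∃ j' : Fin m, (j : ℕ) < (j' : ℕ) ∧ f i j' = true))

/-- The profile of a Catalan tableau: the NW border of its Ferrers diagram read
from the bottom-left corner of the rectangle to its top-right corner
(a = `true` for a north step, b = `false` for an east step), with the first
letter (always a north step) deleted. -/
def CatalanTableau.profile {n : ℕ} (T : CatalanTableau n) : List Bool :=
  ((List.finRange T.k).flatMap (fun i =>
    true :: List.replicate
      (T.lam i - (if h : (i : ℕ) + 1 < T.k then T.lam ⟨(i : ℕ) + 1, h⟩ else 0)) false)).tail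

/-- Number of 1's in the first (bottom) row of a Catalan tableau. -/
noncomputable def CatalanTableau.onesFirstRow {n : ℕ} (T : CatalanTableau n) : ℕ :=
  Nat.card {j : Fin T.m // T.f ⟨0, T.hk⟩ j = true}

/-- An entry is restricted if it is a 0 (in a cell of the diagram) lying above
some 1 in its column. -/
def CatalanTableau.Restricted {n : ℕ} (T : CatalanTableau n)
    (i : Fin T.k) (j : Fin T.m) : Prop :=
  T.m - T.lam i ≤ (j : ℕ) ∧ T.f i j = false ∧ ∃ i' : Fin T.k, i' < i ∧ T.f i' j = true

/-- Number of unrestricted rows (rows of the rectangle containing no restricted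
entry). -/
noncomputable def CatalanTableau.unrestrictedRows {n : ℕ} (T : CatalanTableau n) : ℕ :=
  Nat.card {i : Fin T.k // ∀ j : Fin T.m, ¬ T.Restricted i j}

/-- `weaklyBelow ω η`: the lattice paths coded by `ω`, `η` (a = `true` = north
step, b = `false` = east step, both starting at the origin) have the same
endpoints and `η` never passes strictly above `ω`. -/
def weaklyBelow (ω η : List Bool) : Prop :=
  η.length = ω.length ∧ η.count true = ω.count true ∧
    ∀ t : ℕ, (η.take t).count true ≤ (ω.take t).count true

/-- Heights at which the successive east steps of a path occur. -/
def eastHeightsAux : ℕ → List Bool → List ℕ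
  | _, [] => []
  | h, true :: w => eastHeightsAux (h + 1) w
  | h, false :: w => h :: eastHeightsAux h w

def eastHeights (w : List Bool) : List ℕ := eastHeightsAux 0 w

/-- Number of horizontal contacts of two paths: unit east edges traversed by
both paths. -/
def contacts (ω η : List Bool) : ℕ :=
  ((eastHeights ω).zip (eastHeights η)).countP (fun p => p.1 == p.2)

/-- Number of trailing north steps of a path. -/
def trailingNorth (w : List Bool) : ℕ := (w.reverse.takeWhile (· == true)).length

/-- Number of left edges, i.e. of vertices having a left child. -/
def BinTree.leftEdgeCount : BinTree → ℕ
  | .nil => 0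
  | .node l r => l.leftEdgeCount + r.leftEdgeCount + (if l = BinTree.nil then 0 else 1)

/-- Number of vertices having no right child. -/
def BinTree.noRightCount : BinTree → ℕ
  | .nil => 0
  | .node l r => l.noRightCount + r.noRightCount + (if r = BinTree.nil then 1 else 0)

/-- Symmetric-order traversal recording, for each vertex, whether it has a left
child, whether it has a right child, and its right height (the second argument
is the right height of the current root). -/
def BinTree.inorderAux : BinTree → ℕ → List (Bool × Bool × ℕ)
  | .nil, _ => []
  | .node l r, h =>
      BinTree.inorderAux l h ++
        (decide (l ≠ BinTree.nil), decide (r ≠ BinTree.nil), h) :: BinTree.inorderAux r (h + 1)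

def BinTree.inorder (B : BinTree) : List (Bool × Bool × ℕ) := B.inorderAux 0

/-- The sequence `ρ₁, …, ρ_m`: right heights of the parents of the left edges,
the left edges being ordered by their parents in symmetric order. -/
def BinTree.rhoList (B : BinTree) : List ℕ :=
  (B.inorder.filter (fun v => v.1)).map (fun v => v.2.2)

def hsAux : List (Bool × Bool × ℕ) → ℕ → List ℕ
  | [], _ => []
  | v :: rest, c => if v.2.1 then hsAux rest (c + 1) else c :: hsAux rest c

/-- The sequence `h₁, …, h_m`: for each vertex with no right child (in symmetric
order, excluding the last vertex in symmetric order), the number of vertices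
preceding it in symmetric order that have a right child. -/
def BinTree.hList (B : BinTree) : List ℕ := (hsAux B.inorder 0).dropLast

/-- Leaves of the completion `γ(B)` in symmetric order, each recorded as `true`
if it is a left child of its parent and `false` if it is a right child; the
boolean argument records whether the current subtree sits as a left child. -/
def BinTree.gammaLeavesAux : BinTree → Bool → List Bool
  | .nil, isLeft => [isLeft]
  | .node l r, _ => BinTree.gammaLeavesAux l true ++ BinTree.gammaLeavesAux r false

/-- The word of the leaves of the complete binary tree `γ(B)` in symmetric order
(a = `true` for a left child, b = `false` for a right child). -/
def BinTree.leafWord : BinTree → List Bool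
  | .nil => []
  | .node l r => BinTree.gammaLeavesAux l true ++ BinTree.gammaLeavesAux r false

namespace BinTree

/-- Add a vertex at the end of the symmetric order, at right height `x`: the subtree
hanging at right height `x` on the right branch becomes the left subtree of the new vertex. -/
def insertLast : BinTree → ℕ → BinTree
  | B, 0 => node B nil
  | nil, _ + 1 => node nil nil
  | node l r, x + 1 => node l (r.insertLast x)

@[simp]
theorem insertLast_zero (B : BinTree) : B.insertLast 0 = node B nil := by
  cases B <;> rfl

theorem insertLast_ne_nil (B : BinTree) (x : ℕ) : B.insertLast x ≠ nil := by
  cases B <;> cases x <;> simp [insertLast]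

theorem size_insertLast (B : BinTree) (x : ℕ) (hx : x ≤ B.rightBranchLen) :
    (B.insertLast x).size = B.size + 1 := by
  induction B generalizing x with
  | nil => cases x <;> simp [insertLast, size]
  | node l r _ ih =>
    cases x with
    | zero => simp [insertLast, size]
    | succ x =>
      have := ih x (by simpa [rightBranchLen] using hx)
      simp only [insertLast, size]
      omega

theorem rightBranchLen_insertLast (B : BinTree) (x : ℕ) (hx : x ≤ B.rightBranchLen) :
    (B.insertLast x).rightBranchLen = x + 1 := by
  induction B generalizing x with
  | nil =>
    obtain rfl : x = 0 := by simpa [rightBranchLen] using hx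
    simp [rightBranchLen]
  | node l r _ ih =>
    cases x with
    | zero => simp [insertLast, rightBranchLen]
    | succ x => simp [insertLast, rightBranchLen, ih x (by simpa [rightBranchLen] using hx)]

theorem leftBranchLen_insertLast (B : BinTree) (x : ℕ) (hx : x ≤ B.rightBranchLen) :
    (B.insertLast x).leftBranchLen = B.leftBranchLen + if x = 0 then 1 else 0 := by
  cases x with
  | zero => simp [leftBranchLen]
  | succ x =>
    cases B with
    | nil => simp [rightBranchLen] at hx
    | node l r => simp [insertLast, leftBranchLen]

theorem canopyFull_ne_nil {B : BinTree} (hB : B ≠ nil) : B.canopyFull ≠ [] := by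
  cases B with
  | nil => exact absurd rfl hB
  | node l r => simp [canopyFull]

theorem canopy_node_nil (l : BinTree) : (node l nil).canopy = l.canopyFull := by
  simp [canopy, canopyFull]

theorem canopy_node_of_ne_nil (l : BinTree) {r : BinTree} (hr : r ≠ nil) :
    (node l r).canopy = l.canopyFull ++ true :: r.canopy := by
  rw [canopy, canopyFull, List.dropLast_append_of_ne_nil (by simp),
    List.dropLast_cons_of_ne_nil (canopyFull_ne_nil hr)]
  simp [canopy, hr]

theorem canopyFull_eq_canopy_append {B : BinTree} (hB : B ≠ nil) :
    B.canopyFull = B.canopy ++ [false] := by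
  induction B with
  | nil => exact absurd rfl hB
  | node l r _ ih =>
    by_cases hr : r = nil
    · subst hr
      rw [canopy_node_nil]
      simp [canopyFull]
    · rw [canopy_node_of_ne_nil l hr, canopyFull, ih hr]
      simp [hr]

theorem canopy_insertLast {B : BinTree} (hB : B ≠ nil) (x : ℕ) (hx : x ≤ B.rightBranchLen) :
    (B.insertLast x).canopy = B.canopy ++ [decide (x = B.rightBranchLen)] := by
  induction B generalizing x with
  | nil => exact absurd rfl hB
  | node l r _ ih =>
    cases x with
    | zero =>
      rw [insertLast_zero, canopy_node_nil, canopyFull_eq_canopy_append hB]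
      simp [rightBranchLen]
    | succ x =>
      have hx' : x ≤ r.rightBranchLen := by simpa [rightBranchLen] using hx
      rw [insertLast, canopy_node_of_ne_nil l (insertLast_ne_nil r x)]
      by_cases hr : r = nil
      · subst hr
        obtain rfl : x = 0 := by simpa [rightBranchLen] using hx'
        simp [canopy_node_nil, canopyFull, rightBranchLen]
      · rw [ih hr x hx', canopy_node_of_ne_nil l hr]
        simp [rightBranchLen]

theorem exists_eq_insertLast {B : BinTree} (hB : B ≠ nil) :
    ∃ B' : BinTree, ∃ x ≤ B'.rightBranchLen, B'.insertLast x = B := by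
  induction B with
  | nil => exact absurd rfl hB
  | node l r _ ih =>
    by_cases hr : r = nil
    · exact ⟨l, 0, Nat.zero_le _, by rw [hr, insertLast_zero]⟩
    · obtain ⟨r', x, hx, h⟩ := ih hr
      exact ⟨node l r', x + 1, by simpa [rightBranchLen] using hx, by rw [insertLast, h]⟩

theorem insertLast_left_injective {B C : BinTree} {x : ℕ} (hB : x ≤ B.rightBranchLen)
    (hC : x ≤ C.rightBranchLen) (h : B.insertLast x = C.insertLast x) : B = C := by
  induction B generalizing C x with
  | nil =>
    obtain rfl : x = 0 := by simpa [rightBranchLen] using hB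
    simpa using h
  | node l r _ ih =>
    cases x with
    | zero => simpa using h
    | succ x =>
      cases C with
      | nil => simp [rightBranchLen] at hC
      | node l' r' =>
        simp only [insertLast, node.injEq] at h
        rw [h.1, ih (by simpa [rightBranchLen] using hB) (by simpa [rightBranchLen] using hC) h.2]

theorem size_eq_one {B : BinTree} : B.size = 1 ↔ B = node nil nil := by
  have h0 : ∀ C : BinTree, C.size = 0 ↔ C = nil := by rintro (_ | _) <;> simp [size]
  cases B <;> simp [size, h0]

/-- Trees with `n + 1` vertices are obtained uniquely by inserting a last vertex. -/
noncomputable def insertLastEquiv (n : ℕ) :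
    (Σ B : {B : BinTree // B.size = n}, Fin (B.val.rightBranchLen + 1)) ≃
      {B : BinTree // B.size = n + 1} :=
  Equiv.ofBijective
    (fun p => ⟨p.1.val.insertLast p.2, by
      rw [size_insertLast _ _ (Nat.lt_succ_iff.mp p.2.isLt), p.1.property]⟩) <| by
    constructor
    · rintro ⟨⟨B, hB⟩, x, hx⟩ ⟨⟨C, hC⟩, y, hy⟩ h
      simp only [Subtype.mk.injEq] at h
      simp only at hx hy
      have hxy := congrArg rightBranchLen h
      rw [rightBranchLen_insertLast _ _ (by omega), rightBranchLen_insertLast _ _ (by omega)] at hxy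
      obtain rfl : x = y := by omega
      obtain rfl := insertLast_left_injective (by omega) (by omega) h
      rfl
    · rintro ⟨B, hB⟩
      obtain ⟨B', x, hx, rfl⟩ := exists_eq_insertLast (B := B) (by rintro rfl; simp [size] at hB)
      rw [size_insertLast _ _ hx] at hB
      exact ⟨⟨⟨B', by omega⟩, ⟨x, by simpa [Nat.lt_succ_iff] using hx⟩⟩, rfl⟩

end BinTree

/-- A Catalan tableau recorded by its row lengths and by the row of the unique `1` of each
column, as functions on `ℕ` vanishing outside the rectangle. -/
@[ext]
structure ColumnTableau (n : ℕ) where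
  k : ℕ
  m : ℕ
  k_pos : 0 < k
  k_add_m : k + m = n
  rowLen : ℕ → ℕ
  oneRow : ℕ → ℕ
  rowLen_zero : rowLen 0 = m
  rowLen_anti : ∀ i j, i ≤ j → j < k → rowLen j ≤ rowLen i
  rowLen_of_le : ∀ i, k ≤ i → rowLen i = 0
  oneRow_lt : ∀ j < m, oneRow j < k
  le_of_oneRow : ∀ j < m, m - rowLen (oneRow j) ≤ j
  oneRow_of_le : ∀ j, m ≤ j → oneRow j = 0
  noncrossing : ∀ j j', j < j' → j' < m → oneRow j < oneRow j' → j < m - rowLen (oneRow j')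

namespace ColumnTableau

variable {n : ℕ}

theorem rowLen_le (T : ColumnTableau n) (i : ℕ) : T.rowLen i ≤ T.m := by
  by_cases hi : i < T.k
  · exact (T.rowLen_anti 0 i (Nat.zero_le _) hi).trans_eq T.rowLen_zero
  · simp [T.rowLen_of_le i (not_lt.mp hi)]

/-- Row `i` contains no `0` above the `1` of its column. -/
def Unrestricted (T : ColumnTableau n) (i : ℕ) : Prop :=
  i < T.k ∧ ∀ j < T.m, T.oneRow j < i → j < T.m - T.rowLen i

open Classical in
/-- Number of unrestricted rows. -/
noncomputable def unrestrictedCount (T : ColumnTableau n) : ℕ := Nat.count T.Unrestricted T.k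

/-- Number of columns whose `1` is in the first row. -/
def firstRowCount (T : ColumnTableau n) : ℕ := Nat.count (fun j => T.oneRow j = 0) T.m

/-- The boundary word, including its first letter. -/
def border (T : ColumnTableau n) : List Bool :=
  (List.range T.k).flatMap fun i =>
    true :: List.replicate (T.rowLen i - T.rowLen (i + 1)) false

theorem border_ne_nil (T : ColumnTableau n) : T.border ≠ [] := by
  obtain ⟨K, hK⟩ := Nat.exists_eq_succ_of_ne_zero T.k_pos.ne'
  simp [border, hK, List.range_succ]

theorem unrestricted_zero (T : ColumnTableau n) : T.Unrestricted 0 :=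
  ⟨T.k_pos, fun _ _ h => absurd h (Nat.not_lt_zero _)⟩

theorem unrestrictedCount_pos (T : ColumnTableau n) : 0 < T.unrestrictedCount := by
  classical
  exact Nat.pos_of_ne_zero (Nat.count_ne_iff_exists.mpr ⟨0, T.k_pos, T.unrestricted_zero⟩)

/-- Add an empty row on top. -/
def addRow (T : ColumnTableau n) : ColumnTableau (n + 1) where
  k := T.k + 1
  m := T.m
  k_pos := Nat.succ_pos _
  k_add_m := by have := T.k_add_m; omega
  rowLen := T.rowLen
  oneRow := T.oneRow
  rowLen_zero := T.rowLen_zero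
  rowLen_anti i j hij hj := by
    by_cases h : j < T.k
    · exact T.rowLen_anti i j hij h
    · simp [T.rowLen_of_le j (not_lt.mp h)]
  rowLen_of_le i hi := T.rowLen_of_le i (by omega)
  oneRow_lt j hj := (T.oneRow_lt j hj).trans (Nat.lt_succ_self _)
  le_of_oneRow := T.le_of_oneRow
  oneRow_of_le := T.oneRow_of_le
  noncrossing := T.noncrossing

/-- Add a full column on the right, with its `1` in the unrestricted row `r`. -/
def addCol (T : ColumnTableau n) (r : ℕ) (hr : T.Unrestricted r) : ColumnTableau (n + 1) where
  k := T.k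
  m := T.m + 1
  k_pos := T.k_pos
  k_add_m := by have := T.k_add_m; omega
  rowLen i := if i < T.k then T.rowLen i + 1 else 0
  oneRow j := if j = T.m then r else T.oneRow j
  rowLen_zero := by simp [T.k_pos, T.rowLen_zero]
  rowLen_anti i j hij hj := by
    have := T.rowLen_anti i j hij hj
    simp only [hj, hij.trans_lt hj, if_true]
    omega
  rowLen_of_le i hi := by simp [not_lt.mpr hi]
  oneRow_lt j hj := by
    split_ifs with h
    · exact hr.1
    · exact T.oneRow_lt j (by omega)
  le_of_oneRow j hj := by
    by_cases h : j = T.m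
    · simp [h, hr.1]
    · have h1 := T.oneRow_lt j (by omega)
      have h2 := T.le_of_oneRow j (by omega)
      simp only [h, h1, if_true, if_false]
      omega
  oneRow_of_le j hj := by
    rw [if_neg (by omega), T.oneRow_of_le j (by omega)]
  noncrossing j j' hjj hj' := by
    rw [if_neg (show j ≠ T.m by omega)]
    by_cases h : j' = T.m
    · have := hr.2 j (by omega)
      simp only [h, if_true, hr.1]
      omega
    · have h1 := T.oneRow_lt j' (by omega)
      have h2 := T.noncrossing j j' hjj (by omega)
      simp only [h, h1, if_true, if_false]
      omega

theorem unrestricted_addRow (T : ColumnTableau n) (i : ℕ) :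
    T.addRow.Unrestricted i ↔ T.Unrestricted i ∨ i = T.k := by
  have h := T.rowLen_of_le T.k le_rfl
  simp only [Unrestricted, addRow]
  constructor
  · rintro ⟨h1, h2⟩
    by_cases hi : i = T.k
    · exact Or.inr hi
    · exact Or.inl ⟨by omega, h2⟩
  · rintro (⟨h1, h2⟩ | rfl)
    · exact ⟨by omega, h2⟩
    · exact ⟨by omega, fun j hj _ => by omega⟩

theorem unrestricted_addCol (T : ColumnTableau n) (r : ℕ) (hr : T.Unrestricted r) (i : ℕ) :
    (T.addCol r hr).Unrestricted i ↔ T.Unrestricted i ∧ i ≤ r := by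
  simp only [Unrestricted, addCol]
  constructor
  · rintro ⟨h1, h2⟩
    simp only [h1, if_true] at h2
    refine ⟨⟨h1, fun j hj hj' => ?_⟩, ?_⟩
    · have := h2 j (by omega)
      rw [if_neg (by omega)] at this
      have := this hj'
      omega
    · have := h2 T.m (by omega)
      rw [if_pos rfl] at this
      by_contra! hlt
      have := this hlt
      omega
  · rintro ⟨⟨h1, h2⟩, h3⟩
    refine ⟨h1, fun j hj => ?_⟩
    simp only [h1, if_true]
    split_ifs with h
    · omega
    · intro h4
      have := h2 j (by omega) h4
      omega

theorem unrestrictedCount_addRow (T : ColumnTableau n) :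
    T.addRow.unrestrictedCount = T.unrestrictedCount + 1 := by
  classical
  have hk : T.addRow.Unrestricted T.k := (T.unrestricted_addRow _).mpr (Or.inr rfl)
  have : T.addRow.k = T.k + 1 := rfl
  rw [unrestrictedCount, this, Nat.count_succ, if_pos hk, unrestrictedCount,
    Nat.count_eq_card_filter_range, Nat.count_eq_card_filter_range]
  congr 2
  refine Finset.filter_congr fun i hi => ?_
  have := Finset.mem_range.mp hi
  rw [unrestricted_addRow, or_iff_left (by omega)]

open Classical in
theorem unrestrictedCount_addCol (T : ColumnTableau n) (r : ℕ) (hr : T.Unrestricted r) :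
    (T.addCol r hr).unrestrictedCount = Nat.count T.Unrestricted r + 1 := by
  have h : Nat.count T.Unrestricted (r + 1) = Nat.count T.Unrestricted r + 1 := by
    rw [Nat.count_succ, if_pos hr]
  rw [unrestrictedCount, ← h, Nat.count_eq_card_filter_range, Nat.count_eq_card_filter_range]
  congr 1
  ext i
  have hrk := hr.1
  simp only [Finset.mem_filter, Finset.mem_range, unrestricted_addCol, Nat.lt_succ_iff]
  change i < T.k ∧ _ ↔ _
  constructor
  · rintro ⟨_, h, h'⟩
    exact ⟨h', h⟩
  · rintro ⟨h', h⟩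
    exact ⟨h.1, h, h'⟩

theorem firstRowCount_addRow (T : ColumnTableau n) :
    T.addRow.firstRowCount = T.firstRowCount := rfl

theorem firstRowCount_addCol (T : ColumnTableau n) (r : ℕ) (hr : T.Unrestricted r) :
    (T.addCol r hr).firstRowCount = T.firstRowCount + if r = 0 then 1 else 0 := by
  have : (T.addCol r hr).m = T.m + 1 := rfl
  rw [firstRowCount, this, Nat.count_succ, firstRowCount, Nat.count_eq_card_filter_range,
    Nat.count_eq_card_filter_range]
  congr 2
  · refine Finset.filter_congr fun j hj => ?_
    have := Finset.mem_range.mp hj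
    simp [addCol, show j ≠ T.m by omega]
  · simp [addCol]

theorem border_addRow (T : ColumnTableau n) : T.addRow.border = T.border ++ [true] := by
  simp [border, addRow, List.range_succ, T.rowLen_of_le T.k le_rfl]

theorem border_addCol (T : ColumnTableau n) (r : ℕ) (hr : T.Unrestricted r) :
    (T.addCol r hr).border = T.border ++ [false] := by
  obtain ⟨K, hK⟩ := Nat.exists_eq_succ_of_ne_zero T.k_pos.ne'
  have h0 := T.rowLen_of_le (K + 1) (by omega)
  simp only [border, addCol, hK, Nat.succ_eq_add_one, List.range_succ, List.flatMap_append,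
    List.flatMap_singleton, List.append_assoc]
  congr 1
  · refine List.flatMap_congr fun i hi => ?_
    have := List.mem_range.mp hi
    rw [if_pos (by omega), if_pos (by omega), Nat.add_sub_add_right]
  · simp [h0, List.replicate_succ']

theorem exists_eq_addRow_or_addCol (hn : 1 ≤ n) (T : ColumnTableau (n + 1)) :
    (∃ S : ColumnTableau n, S.addRow = T) ∨
      ∃ (S : ColumnTableau n) (r : ℕ) (hr : S.Unrestricted r), S.addCol r hr = T := by
  have hkm := T.k_add_m
  have hk := T.k_pos
  by_cases h0 : T.rowLen (T.k - 1) = 0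
  · have hk1 : T.k ≠ 1 := by
      intro h
      rw [h, Nat.sub_self, T.rowLen_zero] at h0
      omega
    refine Or.inl ⟨⟨T.k - 1, T.m, by omega, by omega, T.rowLen, T.oneRow, T.rowLen_zero,
      fun i j hij hj => T.rowLen_anti i j hij (by omega), fun i hi => ?_, fun j hj => ?_,
      T.le_of_oneRow, T.oneRow_of_le, T.noncrossing⟩, ?_⟩
    · by_cases h : i = T.k - 1
      · rw [h, h0]
      · exact T.rowLen_of_le i (by omega)
    · have h1 := T.oneRow_lt j hj
      have h2 := T.le_of_oneRow j hj
      by_cases h : T.oneRow j = T.k - 1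
      · rw [h, h0] at h2
        omega
      · omega
    · ext1 <;> simp only [addRow]
      omega
  · have hpos : ∀ i < T.k, 0 < T.rowLen i := fun i hi =>
      (Nat.pos_of_ne_zero h0).trans_le (T.rowLen_anti i (T.k - 1) (by omega) (by omega))
    have hm : 0 < T.m := T.rowLen_zero ▸ hpos 0 hk
    refine Or.inr ⟨⟨T.k, T.m - 1, hk, by omega, fun i => T.rowLen i - 1,
      fun j => if j = T.m - 1 then 0 else T.oneRow j, by rw [T.rowLen_zero],
      fun i j hij hj => Nat.sub_le_sub_right (T.rowLen_anti i j hij hj) 1,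
      fun i hi => by rw [T.rowLen_of_le i hi], fun j hj => ?_, fun j hj => ?_, fun j hj => ?_,
      fun j j' hjj hj' => ?_⟩, T.oneRow (T.m - 1), ⟨T.oneRow_lt _ (by omega), fun j hj => ?_⟩, ?_⟩
    · rw [if_neg (by omega)]
      exact T.oneRow_lt j (by omega)
    · rw [if_neg (by omega)]
      have h1 := hpos _ (T.oneRow_lt j (by omega))
      have h2 := T.le_of_oneRow j (by omega)
      omega
    · split_ifs
      · rfl
      · exact T.oneRow_of_le j (by omega)
    · rw [if_neg (by omega), if_neg (by omega)]
      have h1 := hpos _ (T.oneRow_lt j' (by omega))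
      have h2 := T.noncrossing j j' hjj (by omega)
      omega
    · dsimp only at hj ⊢
      rw [if_neg (by omega)]
      have h1 := hpos _ (T.oneRow_lt (T.m - 1) (by omega))
      have h2 := T.noncrossing j (T.m - 1) (by omega) (by omega)
      omega
    · ext i
      · rfl
      · simp only [addCol]
        omega
      · simp only [addCol]
        split_ifs with hi
        · have := hpos i hi
          omega
        · exact (T.rowLen_of_le i (by omega)).symm
      · simp only [addCol]
        split_ifs with hi
        · rw [hi]
        · rfl

theorem addRow_injective : Function.Injective (addRow (n := n)) := by
  intro S T h
  simp only [addRow, mk.injEq] at h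
  ext1
  · omega
  · exact h.2.1
  · exact h.2.2.1
  · exact h.2.2.2

theorem addCol_inj {S T : ColumnTableau n} {r s : ℕ} {hr : S.Unrestricted r}
    {hs : T.Unrestricted s} (h : S.addCol r hr = T.addCol s hs) : S = T ∧ r = s := by
  simp only [addCol, mk.injEq] at h
  obtain ⟨hk, hm, hL, hR⟩ := h
  have hm : S.m = T.m := by omega
  constructor
  · ext i
    · exact hk
    · exact hm
    · have := congrFun hL i
      by_cases hi : i < S.k
      · rw [if_pos hi, if_pos (hk ▸ hi)] at this
        omega
      · rw [S.rowLen_of_le i (by omega), T.rowLen_of_le i (by omega)]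
    · have := congrFun hR i
      by_cases hi : i = S.m
      · rw [S.oneRow_of_le i (by omega), T.oneRow_of_le i (by omega)]
      · rwa [if_neg hi, if_neg (hm ▸ hi)] at this
  · simpa [hm] using congrFun hR S.m

theorem addRow_ne_addCol (S T : ColumnTableau n) (r : ℕ) (hr : T.Unrestricted r) :
    S.addRow ≠ T.addCol r hr := by
  intro h
  simp only [addRow, addCol, mk.injEq] at h
  have := congrFun h.2.2.1 S.k
  rw [S.rowLen_of_le _ le_rfl, if_pos (by omega)] at this
  omega

open Classical in
theorem unrestricted_nth (T : ColumnTableau n) {x : ℕ} (hx : x < T.unrestrictedCount) :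
    T.Unrestricted (Nat.nth T.Unrestricted x) :=
  Nat.nth_mem x fun hf => hx.trans_le (Nat.count_le_card hf _)

open Classical in
theorem count_nth_unrestricted (T : ColumnTableau n) {x : ℕ} (hx : x < T.unrestrictedCount) :
    Nat.count T.Unrestricted (Nat.nth T.Unrestricted x) = x :=
  Nat.count_nth fun hf => hx.trans_le (Nat.count_le_card hf _)

open Classical in
/-- Add a column with its `1` in the unrestricted row of rank `x`, or an empty row when `x` is
the number of unrestricted rows. -/
noncomputable def extend (T : ColumnTableau n) (x : ℕ) : ColumnTableau (n + 1) :=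
  if hx : x < T.unrestrictedCount then T.addCol _ (T.unrestricted_nth hx) else T.addRow

theorem extend_of_lt (T : ColumnTableau n) {x : ℕ} (hx : x < T.unrestrictedCount) :
    T.extend x = T.addCol _ (T.unrestricted_nth hx) := dif_pos hx

theorem extend_of_eq (T : ColumnTableau n) {x : ℕ} (hx : x = T.unrestrictedCount) :
    T.extend x = T.addRow := dif_neg hx.not_lt

theorem unrestrictedCount_extend (T : ColumnTableau n) (x : ℕ) (hx : x ≤ T.unrestrictedCount) :
    (T.extend x).unrestrictedCount = x + 1 := by
  obtain hx | rfl := hx.lt_or_eq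
  · rw [extend_of_lt T hx, unrestrictedCount_addCol, count_nth_unrestricted T hx]
  · rw [extend_of_eq T rfl, unrestrictedCount_addRow]

theorem firstRowCount_extend (T : ColumnTableau n) (x : ℕ) (hx : x ≤ T.unrestrictedCount) :
    (T.extend x).firstRowCount = T.firstRowCount + if x = 0 then 1 else 0 := by
  classical
  obtain hx | rfl := hx.lt_or_eq
  · rw [extend_of_lt T hx, firstRowCount_addCol]
    congr 1
    refine if_congr ⟨fun h => ?_, fun h => ?_⟩ rfl rfl
    · have := count_nth_unrestricted T hx
      rw [h, Nat.count_zero] at this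
      exact this.symm
    · rw [h]
      exact Nat.nth_zero_of_zero T.unrestricted_zero
  · rw [extend_of_eq T rfl, firstRowCount_addRow, if_neg T.unrestrictedCount_pos.ne', add_zero]

theorem border_extend (T : ColumnTableau n) (x : ℕ) (hx : x ≤ T.unrestrictedCount) :
    (T.extend x).border = T.border ++ [decide (x = T.unrestrictedCount)] := by
  obtain hx | rfl := hx.lt_or_eq
  · rw [extend_of_lt T hx, border_addCol, decide_eq_false hx.ne]
  · rw [extend_of_eq T rfl, border_addRow, decide_eq_true rfl]

/-- Tableaux of index `n + 1` are obtained uniquely by extending one of index `n`. -/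
noncomputable def extendEquiv (hn : 1 ≤ n) :
    (Σ T : ColumnTableau n, Fin (T.unrestrictedCount + 1)) ≃ ColumnTableau (n + 1) :=
  Equiv.ofBijective (fun p => p.1.extend p.2) <| by
    classical
    constructor
    · rintro ⟨S, x, hx⟩ ⟨T, y, hy⟩ h
      simp only at h
      have hxy := congrArg unrestrictedCount h
      rw [unrestrictedCount_extend _ _ (by omega), unrestrictedCount_extend _ _ (by omega)] at hxy
      obtain rfl : x = y := by omega
      obtain rfl : S = T := by
        obtain hxS | hxS := (Nat.lt_succ_iff.mp hx).lt_or_eq <;>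
          obtain hxT | hxT := (Nat.lt_succ_iff.mp hy).lt_or_eq
        · rw [extend_of_lt S hxS, extend_of_lt T hxT] at h
          exact (addCol_inj h).1
        · rw [extend_of_lt S hxS, extend_of_eq T hxT] at h
          exact absurd h.symm (addRow_ne_addCol _ _ _ _)
        · rw [extend_of_lt T hxT, extend_of_eq S hxS] at h
          exact absurd h (addRow_ne_addCol _ _ _ _)
        · rw [extend_of_eq S hxS, extend_of_eq T hxT] at h
          exact addRow_injective h
      rfl
    · intro T
      obtain ⟨S, rfl⟩ | ⟨S, r, hr, rfl⟩ := exists_eq_addRow_or_addCol hn T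
      · exact ⟨⟨S, Fin.last _⟩, S.extend_of_eq rfl⟩
      · have hx : Nat.count S.Unrestricted r < S.unrestrictedCount := by
          rw [unrestrictedCount]
          exact Nat.count_strict_mono hr hr.1
        refine ⟨⟨S, ⟨_, hx.trans (Nat.lt_succ_self _)⟩⟩, ?_⟩
        simp only [extend_of_lt S hx, Nat.nth_count hr]

/-- The tableau of index `1`. -/
def singleRow : ColumnTableau 1 where
  k := 1
  m := 0
  k_pos := Nat.one_pos
  k_add_m := rfl
  rowLen _ := 0
  oneRow _ := 0
  rowLen_zero := rfl
  rowLen_anti _ _ _ _ := le_rfl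
  rowLen_of_le _ _ := rfl
  oneRow_lt _ _ := Nat.one_pos
  le_of_oneRow _ _ := Nat.zero_le _
  oneRow_of_le _ _ := rfl
  noncrossing _ _ _ h := absurd h (Nat.not_lt_zero _)

theorem eq_singleRow (T : ColumnTableau 1) : T = singleRow := by
  have hk := T.k_pos
  have hkm := T.k_add_m
  have hm : T.m = 0 := by omega
  ext i
  · change T.k = 1
    omega
  · exact hm
  · exact Nat.le_zero.mp ((T.rowLen_le i).trans_eq hm)
  · exact T.oneRow_of_le i (by omega)

theorem exists_equiv_binTree (hn : 1 ≤ n) :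
    ∃ e : ColumnTableau n ≃ {B : BinTree // B.size = n},
      ∀ T : ColumnTableau n,
        T.border.tail = (e T).val.canopy ∧
        (e T).val.leftBranchLen = T.firstRowCount + 1 ∧
        (e T).val.rightBranchLen = T.unrestrictedCount := by
  induction n, hn using Nat.le_induction with
  | base =>
    refine ⟨⟨fun _ => ⟨.node .nil .nil, rfl⟩, fun _ => singleRow, fun T => T.eq_singleRow.symm,
      fun B => Subtype.ext (BinTree.size_eq_one.mp B.property).symm⟩, fun T => ?_⟩
    rw [T.eq_singleRow]
    refine ⟨rfl, rfl, ?_⟩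
    classical
    change 1 = Nat.count _ 1
    rw [Nat.count_one, if_pos singleRow.unrestricted_zero]
  | succ n hn ih =>
    obtain ⟨e, he⟩ := ih
    let g : (Σ T : ColumnTableau n, Fin (T.unrestrictedCount + 1)) ≃
        (Σ B : {B : BinTree // B.size = n}, Fin (B.val.rightBranchLen + 1)) :=
      Equiv.sigmaCongr e fun T => finCongr (by rw [(he T).2.2])
    refine ⟨((extendEquiv hn).symm.trans g).trans (BinTree.insertLastEquiv n), fun T => ?_⟩
    obtain ⟨⟨S, x, hx⟩, rfl⟩ := (extendEquiv hn).surjective T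
    obtain ⟨h1, h2, h3⟩ := he S
    have hx' : x ≤ S.unrestrictedCount := Nat.lt_succ_iff.mp hx
    have hxB : x ≤ (e S).val.rightBranchLen := h3 ▸ hx'
    have hB : (e S).val ≠ BinTree.nil := by
      intro h
      have := (e S).property
      rw [h, BinTree.size] at this
      omega
    have hT : extendEquiv hn ⟨S, x, hx⟩ = S.extend x := rfl
    have hE : ((((extendEquiv hn).symm.trans g).trans (BinTree.insertLastEquiv n))
        (extendEquiv hn ⟨S, x, hx⟩)).val = (e S).val.insertLast x := by
      simp only [Equiv.trans_apply, Equiv.symm_apply_apply]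
      rfl
    rw [hE, hT, border_extend S x hx', firstRowCount_extend S x hx',
      unrestrictedCount_extend S x hx', BinTree.canopy_insertLast hB x hxB,
      BinTree.leftBranchLen_insertLast _ x hxB, BinTree.rightBranchLen_insertLast _ x hxB,
      List.tail_append_of_ne_nil S.border_ne_nil, h1, h2, h3]
    exact ⟨rfl, by omega, rfl⟩

end ColumnTableau

namespace CatalanTableau

variable {n : ℕ}

/-- The row of the unique `1` of a column. -/
noncomputable def rowOfOne (T : CatalanTableau n) (j : Fin T.m) : Fin T.k := (T.col_one j).choose

theorem f_eq_true_iff (T : CatalanTableau n) (i : Fin T.k) (j : Fin T.m) :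
    T.f i j = true ↔ T.rowOfOne j = i :=
  ⟨fun h => ((T.col_one j).choose_spec.2 i h).symm,
    fun h => h ▸ (T.col_one j).choose_spec.1⟩

theorem f_eq_false_iff (T : CatalanTableau n) (i : Fin T.k) (j : Fin T.m) :
    T.f i j = false ↔ T.rowOfOne j ≠ i := by
  rw [← Bool.not_eq_true, f_eq_true_iff]

theorem le_of_rowOfOne (T : CatalanTableau n) (j : Fin T.m) :
    T.m - T.lam (T.rowOfOne j) ≤ j := by
  by_contra! h
  exact (T.f_eq_false_iff _ j).mp (T.f_outside _ j h) rfl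

theorem restricted_iff (T : CatalanTableau n) (i : Fin T.k) (j : Fin T.m) :
    T.Restricted i j ↔ T.m - T.lam i ≤ j ∧ T.rowOfOne j < i := by
  simp only [Restricted, f_eq_false_iff, f_eq_true_iff]
  constructor
  · rintro ⟨h1, -, i', h2, rfl⟩
    exact ⟨h1, h2⟩
  · rintro ⟨h1, h2⟩
    exact ⟨h1, h2.ne, _, h2, rfl⟩

/-- The description of a Catalan tableau by row lengths and rows of the `1`s. -/
noncomputable def toColumn (T : CatalanTableau n) : ColumnTableau n where
  k := T.k
  m := T.m
  k_pos := T.hk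
  k_add_m := T.hkm
  rowLen i := if h : i < T.k then T.lam ⟨i, h⟩ else 0
  oneRow j := if h : j < T.m then T.rowOfOne ⟨j, h⟩ else 0
  rowLen_zero := by rw [dif_pos T.hk, T.lam_first]
  rowLen_anti i j hij hj := by
    rw [dif_pos hj, dif_pos (hij.trans_lt hj)]
    exact T.lam_anti _ _ hij
  rowLen_of_le i hi := dif_neg (by omega)
  oneRow_lt j hj := by
    rw [dif_pos hj]
    exact Fin.isLt _
  le_of_oneRow j hj := by
    simpa [hj] using T.le_of_rowOfOne ⟨j, hj⟩
  oneRow_of_le j hj := dif_neg (by omega)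
  noncrossing j j' hjj hj' h := by
    rw [dif_pos hj', dif_pos (hjj.trans hj')] at h
    simp only [hj', dif_pos, Fin.is_lt]
    by_contra! hc
    exact T.no_bad (T.rowOfOne ⟨j', hj'⟩) ⟨j, hjj.trans hj'⟩ hc
      ((T.f_eq_false_iff _ _).mpr (Fin.ne_of_lt h))
      ⟨⟨_, h, (T.f_eq_true_iff _ _).mpr rfl⟩, ⟨⟨j', hj'⟩, hjj, (T.f_eq_true_iff _ _).mpr rfl⟩⟩

theorem toColumn_injective : Function.Injective (toColumn (n := n)) := by
  intro S T h
  have hS := S.f_eq_true_iff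
  have hT := T.f_eq_true_iff
  simp only [toColumn, ColumnTableau.mk.injEq] at h
  obtain ⟨hk, hm, hL, hR⟩ := h
  generalize S.rowOfOne = RS at hS hR
  generalize T.rowOfOne = RT at hT hR
  obtain ⟨k, m, _, _, lam, _, _, _, f, _, _, _⟩ := S
  obtain ⟨k', m', _, _, lam', _, _, _, f', _, _, _⟩ := T
  dsimp only at hk hm
  subst hk hm
  dsimp only at *
  obtain rfl : lam = lam' := by
    funext i
    simpa using congrFun hL i
  obtain rfl : RS = RT := by
    funext j
    simpa [Fin.ext_iff] using congrFun hR j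
  obtain rfl : f = f' := by
    funext i j
    rw [Bool.eq_iff_iff, hS, hT]
  rfl

theorem toColumn_surjective : Function.Surjective (toColumn (n := n)) := by
  intro T
  let S : CatalanTableau n :=
    { k := T.k
      m := T.m
      hk := T.k_pos
      hkm := T.k_add_m
      lam := fun i => T.rowLen i
      lam_le := fun i => T.rowLen_le i
      lam_first := T.rowLen_zero
      lam_anti := fun i j hij => T.rowLen_anti i j hij j.isLt
      f := fun i j => decide (T.oneRow j = i)
      f_outside := fun i j hj => decide_eq_false fun h => by
        have := T.le_of_oneRow j j.isLt
        rw [h] at this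
        omega
      col_one := fun j => ⟨⟨T.oneRow j, T.oneRow_lt j j.isLt⟩, by simp, fun i hi => by
        simpa [Fin.ext_iff, eq_comm] using hi⟩
      no_bad := by
        rintro i j hij - ⟨⟨i', hi', h⟩, j', hj', h'⟩
        simp only [decide_eq_true_eq] at h h'
        have := T.noncrossing j j' hj' j'.isLt (by rw [h, h']; exact hi')
        rw [h'] at this
        omega }
  have hS : ∀ j : Fin T.m, (S.rowOfOne j : ℕ) = T.oneRow j := fun j => by
    have := (S.f_eq_true_iff _ j).mpr rfl
    exact (of_decide_eq_true this).symm
  refine ⟨S, ?_⟩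
  ext i
  · rfl
  · rfl
  · by_cases hi : i < T.k
    · exact dif_pos hi
    · exact (dif_neg hi).trans (T.rowLen_of_le i (by omega)).symm
  · by_cases hi : i < T.m
    · exact (dif_pos hi).trans (hS ⟨i, hi⟩)
    · exact (dif_neg hi).trans (T.oneRow_of_le i (by omega)).symm

theorem profile_eq (T : CatalanTableau n) : T.profile = T.toColumn.border.tail := by
  rw [profile, ColumnTableau.border, toColumn, ← List.map_coe_finRange_eq_range, List.flatMap_map]
  congr 1
  refine List.flatMap_congr fun i _ => ?_
  simp

theorem card_subtype_fin_eq_count {m : ℕ} {p : Fin m → Prop} {q : ℕ → Prop} [DecidablePred q]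
    (h : ∀ i : Fin m, p i ↔ q i) : Nat.card {i : Fin m // p i} = Nat.count q m := by
  let _ := Nat.CountSet.fintype q m
  rw [Nat.count_eq_card_fintype, ← Nat.card_eq_fintype_card]
  exact Nat.card_congr
    { toFun := fun i => ⟨i.val, i.val.isLt, (h _).mp i.property⟩
      invFun := fun i => ⟨⟨i.val, i.property.1⟩, (h _).mpr i.property.2⟩ }

theorem onesFirstRow_eq (T : CatalanTableau n) : T.onesFirstRow = T.toColumn.firstRowCount := by
  refine card_subtype_fin_eq_count fun j => ?_
  simp [f_eq_true_iff, toColumn, Fin.ext_iff]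

theorem unrestrictedRows_eq (T : CatalanTableau n) :
    T.unrestrictedRows = T.toColumn.unrestrictedCount := by
  classical
  refine card_subtype_fin_eq_count fun i => ?_
  simp only [restricted_iff, ColumnTableau.Unrestricted, toColumn, Fin.is_lt, dif_pos, true_and]
  refine ⟨fun h j hj => ?_, fun h j hj => ?_⟩
  · have := h ⟨j, hj⟩
    rw [dif_pos hj]
    intro hlt
    by_contra! hc
    exact this ⟨hc, hlt⟩
  · have := h j j.isLt
    rw [dif_pos j.isLt] at this
    exact (this hj.2).not_ge hj.1

end CatalanTableau

/-- For every integer `n ≥ 1` there exists a bijection `φ` from the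
set of Catalan tableaux of index `n` to the set of binary trees with `n`
vertices such that, for every Catalan tableau `T` of index `n`: (1) the profile
of `T` equals the canopy of `φ(T)`; (2) the length of the left branch of `φ(T)`
equals the number of 1's in the first row of `T`, augmented by 1; (3) the length
of the right branch of `φ(T)` equals the number of unrestricted rows of `T`. -/
theorem catalanTableau_equiv_binTree_full (n : ℕ) (hn : 1 ≤ n) :
    ∃ e : CatalanTableau n ≃ {B : BinTree // B.size = n},
      ∀ T : CatalanTableau n,
        T.profile = (e T).val.canopy ∧
        (e T).val.leftBranchLen = T.onesFirstRow + 1 ∧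
        (e T).val.rightBranchLen = T.unrestrictedRows := by
  obtain ⟨e, he⟩ := ColumnTableau.exists_equiv_binTree hn
  refine ⟨(Equiv.ofBijective CatalanTableau.toColumn
    ⟨CatalanTableau.toColumn_injective, CatalanTableau.toColumn_surjective⟩).trans e, fun T => ?_⟩
  rw [T.profile_eq, T.onesFirstRow_eq, T.unrestrictedRows_eq]
  exact he T.toColumn
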